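/- Let {S_i}_{i=1}^ℓ be contracting similarities of ℝ^d, i.e. dist(S_i x, S_i y) = ρ_i · dist(x, y) for all x, y with 0 < ρ_i < 1, let (p_1, …, p_ℓ) be a probability vector with every p_i > 0, and let μ be a Borel probability measure on ℝ^d satisfying μ(A) = ∑_{i=1}^ℓ p_i μ(S_i^{-1} A) for every Borel set A. Let 𝒟 be a finite collection of Borel subsets of ℝ^d with μ(⋃_{D∈𝒟} D) = 1 and μ(D ∩ D') = 0 for distinct D, D' ∈ 𝒟. Then for μ-a.e. x ∈ ℝ^d, liminf_{r→0⁺} log μ(B̄(x,r)) / log r ≥ [ (∑_{i=1}^ℓ −p_i log p_i) − ∑_{D∈𝒟} f(p_1 μ(S_1^{-1} D), …, p_ℓ μ(S_ℓ^{-1} D)) ] / (∑_{i=1}^ℓ −p_i log ρ_i). -/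

import Mathlib

open MeasureTheory Filter Topology

/-- `φ(t) = -t log t` (with `φ(0) = 0`). -/
noncomputable def phi (t : ℝ) : ℝ := -(t * Real.log t)

/-- `f(x₁,…,x_ℓ) = ∑ φ(xᵢ) - φ(∑ xᵢ)`. -/
noncomputable def fEnt {ℓ : ℕ} (x : Fin ℓ → ℝ) : ℝ :=
  (∑ i, phi (x i)) - phi (∑ i, x i)

/-- The running maxima `max_{k ≤ n} S_k f` of the Birkhoff sums of `f`. -/
noncomputable def birkhoffMax {Ω : Type*} (T : Ω → Ω) (f : Ω → ℝ) : ℕ → Ω → ℝ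
  | 0 => fun _ => 0
  | n + 1 => fun ω => max 0 (f ω + birkhoffMax T f n (T ω))

section BirkhoffMax

variable {Ω : Type*} {T : Ω → Ω} {f : Ω → ℝ}

lemma birkhoffMax_nonneg (n : ℕ) (ω : Ω) : 0 ≤ birkhoffMax T f n ω := by
  cases n with
  | zero => exact le_rfl
  | succ n => exact le_max_left _ _

lemma birkhoffSum_le_birkhoffMax (n : ℕ) (ω : Ω) :
    birkhoffSum T f n ω ≤ birkhoffMax T f n ω := by
  induction n generalizing ω with
  | zero => simp [birkhoffMax]
  | succ n ih =>
    rw [birkhoffSum_succ']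
    exact le_max_of_le_right (by linarith [ih (T ω)])

lemma birkhoffMax_le_succ (n : ℕ) (ω : Ω) :
    birkhoffMax T f n ω ≤ birkhoffMax T f (n + 1) ω := by
  induction n generalizing ω with
  | zero => exact birkhoffMax_nonneg _ _
  | succ n ih =>
    simp only [birkhoffMax]
    exact max_le_max le_rfl (by have := ih (T ω); simp only [birkhoffMax] at this; linarith)

lemma birkhoffMax_mono (ω : Ω) : Monotone fun n => birkhoffMax T f n ω :=
  monotone_nat_of_le_succ fun n => birkhoffMax_le_succ n ω

variable [MeasurableSpace Ω] {m : Measure Ω}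

lemma measurable_birkhoffMax (hT : Measurable T) (hf : Measurable f) (n : ℕ) :
    Measurable (birkhoffMax T f n) := by
  induction n with
  | zero => exact measurable_const
  | succ n ih => exact measurable_const.max (hf.add (ih.comp hT))

lemma integrable_birkhoffMax (hT : MeasurePreserving T m m) (hf : Integrable f m) (n : ℕ) :
    Integrable (birkhoffMax T f n) m := by
  induction n with
  | zero => exact integrable_zero _ _ _
  | succ n ih =>
    exact (integrable_zero _ _ _).sup (hf.add (hT.integrable_comp_of_integrable ih))

/-- The Birkhoff sums of a function of negative mean over an ergodic map are almost surely
bounded above. -/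
theorem Ergodic.ae_exists_birkhoffSum_le (hT : Ergodic T m) (hf : Measurable f)
    (hfi : Integrable f m) (hneg : ∫ ω, f ω ∂m < 0) :
    ∀ᵐ ω ∂m, ∃ C, ∀ n, birkhoffSum T f n ω ≤ C := by
  set F := birkhoffMax T f with hF
  set A : Set Ω := {ω | ∀ C : ℕ, ∃ n, (C : ℝ) < F n ω} with hA
  have hFm := measurable_birkhoffMax (f := f) hT.measurable hf
  have hAm : MeasurableSet A := by
    have : A = ⋂ C : ℕ, ⋃ n, {ω | (C : ℝ) < F n ω} := by ext; simp [hA]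
    rw [this]
    exact .iInter fun C => .iUnion fun n => measurableSet_lt measurable_const (hFm n)
  have hinv : T ⁻¹' A = A := by
    ext ω
    simp only [hA, Set.mem_preimage, Set.mem_ofPred_eq]
    constructor
    · intro h C
      obtain ⟨K, hK⟩ := exists_nat_ge (C - f ω)
      obtain ⟨n, hn⟩ := h K
      exact ⟨n + 1, lt_max_of_lt_right (by linarith)⟩
    · intro h C
      obtain ⟨K, hK⟩ := exists_nat_ge (max 0 (C + f ω))
      obtain ⟨n, hn⟩ := h K
      have h0 := le_of_max_le_left hK
      have h1 := le_of_max_le_right hK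
      cases n with
      | zero => exact absurd hn (not_lt.2 h0)
      | succ n =>
        refine ⟨n, ?_⟩
        rcases lt_max_iff.1 hn with h2 | h2 <;> linarith
  have hA0 : 0 ≤ ∫ ω in A, f ω ∂m := by
    have hlim : Tendsto (fun n => ∫ ω in A, (F (n + 1) ω - F n (T ω)) ∂m) atTop
        (𝓝 (∫ ω in A, f ω ∂m)) := by
      refine tendsto_integral_of_dominated_convergence (fun ω => |f ω|) (fun n => ?_)
        hfi.abs.integrableOn (fun n => ?_) ?_
      · exact ((hFm (n + 1)).sub ((hFm n).comp hT.measurable)).aestronglyMeasurable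
      · refine Eventually.of_forall fun ω => ?_
        have h0 := birkhoffMax_nonneg (T := T) (f := f) n (T ω)
        simp only [hF, birkhoffMax, Real.norm_eq_abs]
        rcases le_total 0 (f ω + birkhoffMax T f n (T ω)) with h | h
        · simp [max_eq_right h]
        · rw [max_eq_left h, zero_sub, abs_neg, abs_of_nonneg h0, abs_of_nonpos] <;> linarith
      · refine (ae_restrict_iff' hAm).2 (Eventually.of_forall fun ω hω => ?_)
        have hω' : T ω ∈ A := by rwa [← Set.mem_preimage, hinv]
        obtain ⟨K, hK⟩ := exists_nat_ge (-f ω)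
        obtain ⟨n, hn⟩ := hω' K
        refine tendsto_const_nhds.congr' ?_
        filter_upwards [eventually_ge_atTop n] with k hk
        have h1 : F n (T ω) ≤ F k (T ω) := birkhoffMax_mono (T ω) hk
        have : F (k + 1) ω = f ω + F k (T ω) := max_eq_right (by linarith)
        rw [this]; ring
    refine ge_of_tendsto' hlim fun n => ?_
    have hFi := integrable_birkhoffMax hT.toMeasurePreserving hfi
    have hFc : Integrable (fun ω => F n (T ω)) m :=
      hT.toMeasurePreserving.integrable_comp_of_integrable (hFi n)
    rw [integral_sub (hFi _).integrableOn hFc.integrableOn]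
    have h2 : ∫ ω in A, F n (T ω) ∂m = ∫ ω in A, F n ω ∂m := by
      conv_lhs => rw [← hinv]
      rw [← (hT.toMeasurePreserving.restrict_preimage hAm).map_eq,
        integral_map hT.measurable.aemeasurable (hFm n).aestronglyMeasurable, hinv]
    rw [h2, sub_nonneg]
    exact integral_mono (hFi n).integrableOn (hFi _).integrableOn fun ω => birkhoffMax_le_succ n ω
  rcases hT.ae_empty_or_univ hAm hinv with h | h
  · filter_upwards [measure_eq_zero_iff_ae_notMem.1 (ae_eq_empty.1 h)] with ω hω
    simp only [hA, Set.mem_ofPred_eq, not_forall, not_exists, not_lt] at hω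
    obtain ⟨C, hC⟩ := hω
    exact ⟨C, fun n => (birkhoffSum_le_birkhoffMax n ω).trans (hC n)⟩
  · rw [setIntegral_congr_set h, setIntegral_univ] at hA0
    linarith

end BirkhoffMax

/-- The left shift on one-sided sequences. -/
def seqShift {α : Type*} (ω : ℕ → α) : ℕ → α := fun n => ω (n + 1)

/-- The sequence with first term `q.1`, followed by the sequence `q.2`. -/
def seqCons {α : Type*} (q : α × (ℕ → α)) : ℕ → α := fun n => Nat.casesOn n q.1 q.2

section Shift

variable {α : Type*}

@[simp] lemma seqShift_seqCons (q : α × (ℕ → α)) : seqShift (seqCons q) = q.2 := rfl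

@[simp] lemma seqCons_zero (q : α × (ℕ → α)) : seqCons q 0 = q.1 := rfl

lemma seqShift_iterate (n k : ℕ) (ω : ℕ → α) : seqShift^[n] ω k = ω (k + n) := by
  induction n generalizing ω with
  | zero => rfl
  | succ n ih => rw [Function.iterate_succ_apply, ih]; simp [seqShift, add_assoc]

variable [MeasurableSpace α]

lemma measurable_seqShift : Measurable (seqShift (α := α)) :=
  measurable_pi_lambda _ fun n => measurable_pi_apply (n + 1)

lemma measurable_seqCons : Measurable (seqCons (α := α)) := by
  refine measurable_pi_lambda _ fun n => ?_
  cases n with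
  | zero => exact measurable_fst
  | succ n => exact (measurable_pi_apply n).comp measurable_snd

variable (P : Measure α) [IsProbabilityMeasure P]

lemma map_seqCons_prod :
    (P.prod (Measure.infinitePi fun _ : ℕ => P)).map seqCons
      = Measure.infinitePi fun _ : ℕ => P := by
  classical
  refine Measure.eq_infinitePi _ fun s t ht => ?_
  set u : ℕ → Set α := fun n => if n ∈ s then t n else Set.univ with hu
  have hum : ∀ n, MeasurableSet (u n) := fun n => by
    by_cases h : n ∈ s <;> simp [hu, h, ht]
  obtain ⟨N, hN⟩ := s.exists_nat_subset_range
  have h1 : seqCons ⁻¹' (Set.pi s t) =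
      u 0 ×ˢ (Set.pi (Finset.range N : Set ℕ) fun n => u (n + 1)) := by
    ext ⟨i, ω⟩
    simp only [Set.mem_preimage, Set.mem_pi, Finset.mem_coe, Set.mem_prod, hu]
    constructor
    · intro h
      refine ⟨?_, fun n _ => ?_⟩
      · split_ifs with h0
        · exact h 0 h0
        · trivial
      · split_ifs with h0
        · exact h (n + 1) h0
        · trivial
    · rintro ⟨h0, h⟩ n hn
      cases n with
      | zero => simpa [hn] using h0
      | succ n =>
        have := h n (Finset.mem_range.2 (by have := Finset.mem_range.1 (hN hn); omega))
        rw [if_pos hn] at this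
        exact this
  have hst : MeasurableSet (Set.pi (s : Set ℕ) t) :=
    .pi s.countable_toSet fun n _ => ht n
  rw [Measure.map_apply measurable_seqCons hst, h1, Measure.prod_prod,
    Measure.infinitePi_pi _ fun n _ => hum _, mul_comm,
    ← Finset.prod_range_succ' (fun n => P (u n)) N]
  symm
  refine Finset.prod_subset_one_on_sdiff (fun n hn => ?_) (fun n hn => ?_) fun n hn => ?_
  · have := Finset.mem_range.1 (hN hn)
    exact Finset.mem_range.2 (by omega)
  · simp [hu, (Finset.mem_sdiff.1 hn).2]
  · simp [hu, hn]

lemma lintegral_infinitePi_seqCons {F : (ℕ → α) → ENNReal} (hF : Measurable F) :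
    ∫⁻ ω, F ω ∂(Measure.infinitePi fun _ : ℕ => P)
      = ∫⁻ i, ∫⁻ ω, F (seqCons (i, ω)) ∂(Measure.infinitePi fun _ : ℕ => P) ∂P := by
  conv_lhs => rw [← map_seqCons_prod P]
  rw [lintegral_map hF measurable_seqCons]
  exact lintegral_prod _ (hF.comp measurable_seqCons).aemeasurable

lemma measurePreserving_seqShift :
    MeasurePreserving seqShift (Measure.infinitePi fun _ : ℕ => P)
      (Measure.infinitePi fun _ : ℕ => P) := by
  refine ⟨measurable_seqShift, ?_⟩
  conv_lhs => rw [← map_seqCons_prod P]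
  rw [Measure.map_map measurable_seqShift measurable_seqCons]
  exact (Measure.map_snd_prod ..).trans (by simp)

/-- The shift is ergodic for the Bernoulli measures. -/
lemma ergodic_seqShift :
    Ergodic seqShift (Measure.infinitePi fun _ : ℕ => P) := by
  refine ⟨measurePreserving_seqShift P, ⟨fun A hA hinv => ?_⟩⟩
  have hind : ProbabilityTheory.iIndep
      (fun n : ℕ => MeasurableSpace.comap (fun ω : ℕ → α => ω n) inferInstance)
      (Measure.infinitePi fun _ : ℕ => P) :=
    ProbabilityTheory.iIndepFun_infinitePi (P := fun _ : ℕ => P) (X := fun _ ω => ω)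
      fun _ => measurable_id
  have htail : MeasurableSet[limsup (fun n : ℕ =>
      MeasurableSpace.comap (fun ω : ℕ → α => ω n) inferInstance) atTop] A := by
    rw [limsup_eq_iInf_iSup_of_nat, MeasurableSpace.measurableSet_iInf]
    intro n
    have hA' : A = seqShift^[n] ⁻¹' A := by
      induction n with
      | zero => rfl
      | succ n ih => rw [Function.iterate_succ, Set.preimage_comp, ← ih, hinv]
    rw [hA']
    have hmeas : @Measurable _ _ (⨆ i ≥ n, MeasurableSpace.comap (fun ω : ℕ → α => ω i)
        inferInstance) _ (seqShift (α := α))^[n] := by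
      refine @measurable_pi_lambda _ _ _ (_) _ _ fun k => ?_
      have : (fun ω : ℕ → α => seqShift^[n] ω k) = fun ω => ω (k + n) :=
        funext fun ω => seqShift_iterate n k ω
      rw [this]
      refine Measurable.mono (comap_measurable _) ?_ le_rfl
      exact le_iSup₂_of_le (k + n) (Nat.le_add_left _ _) le_rfl
    exact hmeas hA
  have := ProbabilityTheory.measure_zero_or_one_of_measurableSet_limsup_atTop
    (fun n => (measurable_pi_apply n).comap_le) hind htail
  rw [eventuallyConst_set']
  rcases this with h | h
  · exact .inl (ae_eq_empty.2 h)
  · exact .inr ((mem_ae_iff_prob_eq_one hA).2 h |> eventuallyEq_univ.2)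

end Shift

/-- A weak type maximal inequality for the ratio of two measures on balls, with a constant
depending only on the space. -/
theorem exists_measure_closedBall_le_mul_le (E : Type*) [MetricSpace E]
    [SecondCountableTopology E] [HasBesicovitchCovering E] [MeasurableSpace E]
    [OpensMeasurableSpace E] :
    ∃ N : ℕ, ∀ (μ ν : Measure E) (t : ENNReal) (R : ℝ),
      ν {x | ∃ r, 0 < r ∧ r ≤ R ∧
        ν (Metric.closedBall x r) ≤ t * μ (Metric.closedBall x r)} ≤ N * (t * μ Set.univ) := by
  obtain ⟨N, τ, hτ, hN⟩ := HasBesicovitchCovering.no_satelliteConfig (α := E)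
  refine ⟨N, fun μ ν t R => ?_⟩
  set A := {x | ∃ r, 0 < r ∧ r ≤ R ∧
    ν (Metric.closedBall x r) ≤ t * μ (Metric.closedBall x r)} with hA
  choose r hr0 hrR hr using fun x : A => x.2
  let q : Besicovitch.BallPackage A E := ⟨Subtype.val, r, hr0, R, hrR⟩
  obtain ⟨s, hs, hcov⟩ := Besicovitch.exist_disjoint_covering_families hτ hN q
  have hcount : ∀ i, (s i).Countable := fun i =>
    (hs i).countable_of_nonempty_interior fun x _ =>
      ⟨x, Metric.ball_subset_interior_closedBall (Metric.mem_ball_self (hr0 x))⟩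
  have hsub : A ⊆ ⋃ i : Fin N, ⋃ j ∈ s i, Metric.closedBall (q.c j) (q.r j) := by
    intro x hx
    have := hcov ⟨⟨x, hx⟩, rfl⟩
    simp only [Set.mem_iUnion] at this ⊢
    obtain ⟨i, j, hj, hxj⟩ := this
    exact ⟨i, j, hj, Metric.ball_subset_closedBall hxj⟩
  calc ν A ≤ ν (⋃ i : Fin N, ⋃ j ∈ s i, Metric.closedBall (q.c j) (q.r j)) := measure_mono hsub
    _ ≤ ∑ i : Fin N, ν (⋃ j ∈ s i, Metric.closedBall (q.c j) (q.r j)) :=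
        measure_iUnion_fintype_le _ _
    _ ≤ ∑ _i : Fin N, t * μ Set.univ := by
        refine Finset.sum_le_sum fun i _ => ?_
        calc ν (⋃ j ∈ s i, Metric.closedBall (q.c j) (q.r j))
            ≤ ∑' j : s i, ν (Metric.closedBall (q.c j) (q.r j)) :=
              measure_biUnion_le _ (hcount i) _
          _ ≤ ∑' j : s i, t * μ (Metric.closedBall (q.c j) (q.r j)) :=
              ENNReal.tsum_le_tsum fun j => hr j
          _ = t * μ (⋃ j ∈ s i, Metric.closedBall (q.c j) (q.r j)) := by
              rw [ENNReal.tsum_mul_left,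
                measure_biUnion (hcount i) (hs i) fun _ _ => measurableSet_closedBall]
          _ ≤ t * μ Set.univ := by gcongr; exact Set.subset_univ _
    _ = N * (t * μ Set.univ) := by simp

lemma measurable_measure_closedBall {E : Type*} [PseudoMetricSpace E]
    [SecondCountableTopology E] [MeasurableSpace E] [OpensMeasurableSpace E]
    (μ : Measure E) [SFinite μ] :
    Measurable fun q : E × ℝ => μ (Metric.closedBall q.1 q.2) := by
  have h : MeasurableSet {z : (E × ℝ) × E | dist z.2 z.1.1 ≤ z.1.2} :=
    measurableSet_le (by fun_prop) (by fun_prop)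
  exact measurable_measure_prodMk_left h

lemma ENNReal.le_tsum_indicator_natCast_lt (x : ENNReal) :
    x ≤ ∑' k : ℕ, if (k : ENNReal) < x then 1 else 0 := by
  rcases eq_or_ne x ⊤ with rfl | hx
  · simp
  · lift x to NNReal using hx
    calc (x : ENNReal) ≤ (⌈x⌉₊ : ℕ) := by exact_mod_cast Nat.le_ceil x
      _ = ∑ k ∈ Finset.range ⌈x⌉₊, if (k : ENNReal) < x then 1 else 0 := by
          rw [Finset.sum_congr rfl fun k hk => if_pos ?_]
          · simp
          · exact_mod_cast Nat.lt_ceil.1 (Finset.mem_range.1 hk)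
      _ ≤ _ := ENNReal.sum_le_tsum _

lemma lintegral_le_tsum_measure_natCast_lt {Ω : Type*} [MeasurableSpace Ω] (m : Measure Ω)
    {f : Ω → ENNReal} (hf : Measurable f) :
    ∫⁻ ω, f ω ∂m ≤ ∑' k : ℕ, m {ω | (k : ENNReal) < f ω} := by
  have hk : ∀ k : ℕ, MeasurableSet {ω | (k : ENNReal) < f ω} := fun k =>
    measurableSet_lt measurable_const hf
  calc ∫⁻ ω, f ω ∂m
      ≤ ∫⁻ ω, ∑' k : ℕ, {ω | (k : ENNReal) < f ω}.indicator 1 ω ∂m := by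
        refine lintegral_mono fun ω => (ENNReal.le_tsum_indicator_natCast_lt (f ω)).trans_eq ?_
        simp [Set.indicator_apply]
    _ = _ := by
        rw [lintegral_tsum fun k => (measurable_one.indicator (hk k)).aemeasurable]
        simp [lintegral_indicator_one (hk _)]

/-- Jensen's inequality for the entropy of the density of `ν ≤ μ` on a set. -/
lemma setIntegral_negMulLog_rnDeriv_le {E : Type*} [MeasurableSpace E] {μ ν : Measure E}
    [IsFiniteMeasure μ] (hle : ν ≤ μ) (D : Set E) :
    IntegrableOn (fun x => Real.negMulLog (ν.rnDeriv μ x).toReal) D μ ∧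
    ∫ x in D, Real.negMulLog (ν.rnDeriv μ x).toReal ∂μ
      ≤ phi (ν.real D) + ν.real D * Real.log (μ.real D) := by
  have : IsFiniteMeasure ν := isFiniteMeasure_of_le μ hle
  have hac : ν ≪ μ := Measure.absolutelyContinuous_of_le hle
  have h1 : ∀ᵐ x ∂μ, (ν.rnDeriv μ x).toReal ≤ 1 := by
    filter_upwards [Measure.rnDeriv_le_one_of_le hle] with x hx
    exact ENNReal.toReal_mono ENNReal.one_ne_top hx
  have hint : Integrable (fun x => Real.negMulLog (ν.rnDeriv μ x).toReal) μ := by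
    refine Integrable.of_bound (C := 1) ?_ ?_
    · exact (Real.continuous_negMulLog.measurable.comp
        (Measure.measurable_rnDeriv ν μ).ennreal_toReal).aestronglyMeasurable
    · filter_upwards [h1] with x hx
      rw [Real.norm_eq_abs, abs_of_nonneg (Real.negMulLog_nonneg ENNReal.toReal_nonneg hx)]
      have := Real.negMulLog_le_one_sub_self (ENNReal.toReal_nonneg (a := ν.rnDeriv μ x))
      linarith [ENNReal.toReal_nonneg (a := ν.rnDeriv μ x)]
  refine ⟨hint.integrableOn, ?_⟩
  by_cases hD : μ D = 0
  · rw [setIntegral_measure_zero _ hD]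
    simp [phi, measureReal_def, hD, hac hD]
  have hpos : 0 < μ.real D := ENNReal.toReal_pos hD (measure_ne_top _ _)
  have hJ := Real.concaveOn_negMulLog.le_map_set_average (μ := μ) (t := D)
    (f := fun x => (ν.rnDeriv μ x).toReal) Real.continuous_negMulLog.continuousOn isClosed_Ici hD
    (measure_ne_top _ _) (Eventually.of_forall fun x => ENNReal.toReal_nonneg)
    Measure.integrable_toReal_rnDeriv.integrableOn hint.integrableOn
  rw [setAverage_eq, setAverage_eq, Measure.setIntegral_toReal_rnDeriv hac, smul_eq_mul,
    smul_eq_mul, inv_mul_le_iff₀ hpos] at hJ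
  refine hJ.trans_eq ?_
  by_cases hν : ν.real D = 0
  · simp [hν, phi]
  · rw [Real.negMulLog, phi, inv_mul_eq_div, Real.log_div hν hpos.ne']
    field_simp
    ring

lemma lintegral_neg_log_rnDeriv_le {E : Type*} [MeasurableSpace E] {μ ν : Measure E}
    [IsFiniteMeasure μ] (hle : ν ≤ μ) (𝒟 : Finset (Set E))
    (hcov : ∀ᵐ x ∂μ, x ∈ ⋃ D ∈ 𝒟, D) :
    ∫⁻ x, ENNReal.ofReal (-Real.log (ν.rnDeriv μ x).toReal) ∂ν
      ≤ ENNReal.ofReal (∑ D ∈ 𝒟, (phi (ν.real D) + ν.real D * Real.log (μ.real D))) := by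
  have : IsFiniteMeasure ν := isFiniteMeasure_of_le μ hle
  have hac : ν ≪ μ := Measure.absolutelyContinuous_of_le hle
  have h1 : ∀ᵐ x ∂μ, (ν.rnDeriv μ x).toReal ≤ 1 := by
    filter_upwards [Measure.rnDeriv_le_one_of_le hle] with x hx
    exact ENNReal.toReal_mono ENNReal.one_ne_top hx
  have hnn : ∀ᵐ x ∂μ, 0 ≤ Real.negMulLog (ν.rnDeriv μ x).toReal := by
    filter_upwards [h1] with x hx using Real.negMulLog_nonneg ENNReal.toReal_nonneg hx
  have hDle := fun D : Set E => setIntegral_negMulLog_rnDeriv_le hle D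
  calc ∫⁻ x, ENNReal.ofReal (-Real.log (ν.rnDeriv μ x).toReal) ∂ν
      = ∫⁻ x, ν.rnDeriv μ x * ENNReal.ofReal (-Real.log (ν.rnDeriv μ x).toReal) ∂μ := by
        rw [lintegral_rnDeriv_mul hac]
        exact (Measure.measurable_rnDeriv ν μ).ennreal_toReal.log.neg.ennreal_ofReal.aemeasurable
    _ = ∫⁻ x, ENNReal.ofReal (Real.negMulLog (ν.rnDeriv μ x).toReal) ∂μ := by
        refine lintegral_congr_ae ?_
        filter_upwards [Measure.rnDeriv_lt_top ν μ] with x hx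
        rw [Real.negMulLog, neg_mul_comm, ENNReal.ofReal_mul ENNReal.toReal_nonneg,
          ENNReal.ofReal_toReal hx.ne]
    _ = ∫⁻ x in ⋃ D : 𝒟, (D : Set E),
          ENNReal.ofReal (Real.negMulLog (ν.rnDeriv μ x).toReal) ∂μ := by
        rw [Measure.restrict_eq_self_of_ae_mem]
        filter_upwards [hcov] with x hx
        simpa using hx
    _ ≤ ∑' D : 𝒟, ∫⁻ x in (D : Set E),
          ENNReal.ofReal (Real.negMulLog (ν.rnDeriv μ x).toReal) ∂μ := lintegral_iUnion_le _ _
    _ = ∑ D ∈ 𝒟, ENNReal.ofReal (∫ x in D, Real.negMulLog (ν.rnDeriv μ x).toReal ∂μ) := by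
        rw [Finset.tsum_subtype 𝒟 fun D => ∫⁻ x in D,
          ENNReal.ofReal (Real.negMulLog (ν.rnDeriv μ x).toReal) ∂μ]
        refine Finset.sum_congr rfl fun D _ => ?_
        rw [ofReal_integral_eq_lintegral_ofReal (hDle D).1 (ae_restrict_of_ae hnn)]
    _ = ENNReal.ofReal (∑ D ∈ 𝒟, ∫ x in D, Real.negMulLog (ν.rnDeriv μ x).toReal ∂μ) :=
        (ENNReal.ofReal_sum_of_nonneg fun D _ =>
          integral_nonneg_of_ae (ae_restrict_of_ae hnn)).symm
    _ ≤ _ := ENNReal.ofReal_le_ofReal (Finset.sum_le_sum fun D _ => (hDle D).2)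

/-- The composition `S (ω 0) ∘ ⋯ ∘ S (ω (n - 1))`. -/
def wordMap {α E : Type*} (S : α → E → E) : ℕ → (ℕ → α) → E → E
  | 0 => fun _ x => x
  | n + 1 => fun ω x => S (ω 0) (wordMap S n (seqShift ω) x)

/-- The product `ρ (ω 0) ⋯ ρ (ω (n - 1))`. -/
def wordRatio {α : Type*} (ρ : α → ℝ) : ℕ → (ℕ → α) → ℝ
  | 0 => fun _ => 1
  | n + 1 => fun ω => ρ (ω 0) * wordRatio ρ n (seqShift ω)

section WordRatio

variable {α : Type*} {ρ : α → ℝ}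

lemma wordRatio_pos (hρ : ∀ i, 0 < ρ i) (n : ℕ) (ω : ℕ → α) : 0 < wordRatio ρ n ω := by
  induction n generalizing ω with
  | zero => exact one_pos
  | succ n ih => exact mul_pos (hρ _) (ih _)

lemma wordRatio_le_pow (hρ : ∀ i, 0 < ρ i) {θ : ℝ} (hθ : ∀ i, ρ i ≤ θ) (n : ℕ) (ω : ℕ → α) :
    wordRatio ρ n ω ≤ θ ^ n := by
  induction n generalizing ω with
  | zero => simp [wordRatio]
  | succ n ih =>
    rw [pow_succ']
    exact mul_le_mul (hθ _) (ih _) (wordRatio_pos hρ _ _).le ((hρ (ω 0)).le.trans (hθ _))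

lemma pow_le_wordRatio {b : ℝ} (hb : 0 ≤ b) (hbρ : ∀ i, b ≤ ρ i) (n : ℕ) (ω : ℕ → α) :
    b ^ n ≤ wordRatio ρ n ω := by
  induction n generalizing ω with
  | zero => simp [wordRatio]
  | succ n ih =>
    rw [pow_succ']
    exact mul_le_mul (hbρ _) (ih _) (pow_nonneg hb n) (hb.trans (hbρ _))

lemma wordRatio_mul_pow_le (hρ : ∀ i, 0 < ρ i) {b : ℝ} (hb : 0 ≤ b) (hbρ : ∀ i, b ≤ ρ i)
    (n k : ℕ) (ω : ℕ → α) : wordRatio ρ n ω * b ^ k ≤ wordRatio ρ (n + k) ω := by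
  induction n generalizing ω with
  | zero => simpa [wordRatio] using pow_le_wordRatio hb hbρ k ω
  | succ n ih =>
    rw [Nat.succ_add]
    simp only [wordRatio, mul_assoc]
    exact mul_le_mul_of_nonneg_left (ih _) (hρ _).le

end WordRatio

section Coding

variable {E : Type*} [MetricSpace E] {ℓ : ℕ} {S : Fin ℓ → E → E} {ρ : Fin ℓ → ℝ}

lemma dist_wordMap (hS : ∀ i x y, dist (S i x) (S i y) = ρ i * dist x y) (n : ℕ)
    (ω : ℕ → Fin ℓ) (x y : E) :
    dist (wordMap S n ω x) (wordMap S n ω y) = wordRatio ρ n ω * dist x y := by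
  induction n generalizing ω with
  | zero => simp [wordMap, wordRatio]
  | succ n ih => simp only [wordMap, wordRatio, hS, ih, mul_assoc]

lemma wordMap_succ' {α E : Type*} (S : α → E → E) (n : ℕ) (ω : ℕ → α) (x : E) :
    wordMap S (n + 1) ω x = wordMap S n ω (S (ω n) x) := by
  induction n generalizing ω with
  | zero => rfl
  | succ n ih =>
    change S (ω 0) (wordMap S (n + 1) (seqShift ω) x) = _
    rw [ih]
    rfl

/-- The coding map of an iterated function system of contracting similarities. -/
lemma exists_coding [CompleteSpace E] [Nonempty E] (hρ0 : ∀ i, 0 < ρ i) {θ : ℝ} (hθ1 : θ < 1)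
    (hρθ : ∀ i, ρ i ≤ θ) (hS : ∀ i x y, dist (S i x) (S i y) = ρ i * dist x y) :
    ∃ π : (ℕ → Fin ℓ) → E,
      ∀ ω x, Tendsto (fun n => wordMap S n ω x) atTop (𝓝 (π ω)) := by
  obtain ⟨x₀⟩ := ‹Nonempty E›
  have key : ∀ ω : ℕ → Fin ℓ, ∃ z, Tendsto (fun n => wordMap S n ω x₀) atTop (𝓝 z) := by
    intro ω
    obtain ⟨C, hC⟩ := (Set.finite_range fun i => dist x₀ (S i x₀)).bddAbove
    refine cauchySeq_tendsto_of_complete (cauchySeq_of_le_geometric θ C hθ1 fun n => ?_)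
    have hC' : dist x₀ (S (ω n) x₀) ≤ C := hC ⟨_, rfl⟩
    rw [wordMap_succ', dist_wordMap hS, mul_comm]
    exact mul_le_mul hC' (wordRatio_le_pow hρ0 hρθ n ω) (wordRatio_pos hρ0 n ω).le
      (dist_nonneg.trans hC')
  choose π hπ using key
  refine ⟨π, fun ω x => ?_⟩
  have hθ0 : 0 ≤ θ := (hρ0 (ω 0)).le.trans (hρθ _)
  refine tendsto_of_tendsto_of_dist (hπ ω) ?_
  simp only [dist_wordMap hS]
  refine squeeze_zero (fun n => mul_nonneg (wordRatio_pos hρ0 n ω).le dist_nonneg)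
    (fun n => mul_le_mul_of_nonneg_right (wordRatio_le_pow hρ0 hρθ n ω) dist_nonneg) ?_
  simpa using (tendsto_pow_atTop_nhds_zero_of_lt_one hθ0 hθ1).mul_const (dist x₀ x)

variable {π : (ℕ → Fin ℓ) → E}

lemma coding_eq [Nonempty E] (hcont : ∀ i, Continuous (S i))
    (hπ : ∀ ω x, Tendsto (fun n => wordMap S n ω x) atTop (𝓝 (π ω))) (ω : ℕ → Fin ℓ) :
    π ω = S (ω 0) (π (seqShift ω)) := by
  obtain ⟨x₀⟩ := ‹Nonempty E›
  exact tendsto_nhds_unique ((hπ ω x₀).comp (tendsto_add_atTop_nat 1))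
    (((hcont (ω 0)).tendsto _).comp (hπ (seqShift ω) x₀))

lemma exists_dist_coding_le [Nonempty E] (hρ0 : ∀ i, 0 < ρ i) {θ : ℝ} (hθ1 : θ < 1)
    (hρθ : ∀ i, ρ i ≤ θ) (hS : ∀ i x y, dist (S i x) (S i y) = ρ i * dist x y)
    (hπ : ∀ ω x, Tendsto (fun n => wordMap S n ω x) atTop (𝓝 (π ω))) :
    ∃ K : ℝ, 0 < K ∧ ∀ ω ω', dist (π ω) (π ω') ≤ K := by
  obtain ⟨x₀⟩ := ‹Nonempty E›
  obtain ⟨C, hC⟩ := (Set.finite_range fun i => dist (S i x₀) x₀).bddAbove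
  set K := max C 0 / (1 - θ) with hK
  have hK0 : 0 ≤ K := div_nonneg (le_max_right _ _) (by linarith)
  have hKC : θ * K + C ≤ K := by
    have : K * (1 - θ) = max C 0 := div_mul_cancel₀ _ (by linarith)
    nlinarith [le_max_left C 0]
  have hw : ∀ n ω, dist (wordMap S n ω x₀) x₀ ≤ K := by
    intro n
    induction n with
    | zero => intro ω; simpa [wordMap] using hK0
    | succ n ih =>
      intro ω
      have h1 : dist (S (ω 0) x₀) x₀ ≤ C := hC ⟨_, rfl⟩
      calc dist (wordMap S (n + 1) ω x₀) x₀
          ≤ dist (S (ω 0) (wordMap S n (seqShift ω) x₀)) (S (ω 0) x₀)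
              + dist (S (ω 0) x₀) x₀ := dist_triangle _ _ _
        _ ≤ θ * K + C := by
            rw [hS]
            exact add_le_add (mul_le_mul (hρθ _) (ih _) dist_nonneg
              ((hρ0 (ω 0)).le.trans (hρθ _))) h1
        _ ≤ K := hKC
  have hb : ∀ ω, dist (π ω) x₀ ≤ K := fun ω =>
    le_of_tendsto' ((hπ ω x₀).dist tendsto_const_nhds) fun n => hw n ω
  refine ⟨2 * K + 1, by linarith, fun ω ω' => ?_⟩
  linarith [dist_triangle_right (π ω) (π ω') x₀, hb ω, hb ω']

variable [MeasurableSpace E] [BorelSpace E]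

lemma measurable_wordMap (hcont : ∀ i, Continuous (S i)) (n : ℕ) :
    Measurable fun q : (ℕ → Fin ℓ) × E => wordMap S n q.1 q.2 := by
  induction n with
  | zero => exact measurable_snd
  | succ n ih =>
    have h : Measurable fun q : Fin ℓ × E => S q.1 q.2 :=
      measurable_from_prod_countable_right fun i => (hcont i).measurable
    exact h.comp (((measurable_pi_apply 0).comp measurable_fst).prodMk
      (ih.comp ((measurable_seqShift.comp measurable_fst).prodMk measurable_snd)))

lemma measurable_coding [Nonempty E] (hcont : ∀ i, Continuous (S i))
    (hπ : ∀ ω x, Tendsto (fun n => wordMap S n ω x) atTop (𝓝 (π ω))) : Measurable π := by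
  obtain ⟨x₀⟩ := ‹Nonempty E›
  exact measurable_of_tendsto_metrizable
    (fun n => (measurable_wordMap hcont n).comp (measurable_id.prodMk measurable_const))
    (tendsto_pi_nhds.2 fun ω => hπ ω x₀)

variable {P : Measure (Fin ℓ)} [IsProbabilityMeasure P] {μ : Measure E} [IsProbabilityMeasure μ]

lemma map_wordMap (hcont : ∀ i, Continuous (S i))
    (hμ : μ = ∑ i, P {i} • μ.map (S i)) (n : ℕ) :
    ((Measure.infinitePi fun _ : ℕ => P).prod μ).map (fun q => wordMap S n q.1 q.2) = μ := by
  induction n with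
  | zero => exact (Measure.map_snd_prod ..).trans (by simp)
  | succ n ih =>
    refine Measure.ext_of_lintegral _ fun F hF => ?_
    have hm := fun n => measurable_wordMap hcont (S := S) n
    have hlm : ∀ n, Measurable fun ω => ∫⁻ x, F (wordMap S n ω x) ∂μ := fun n =>
      (hF.comp (hm n)).lintegral_prod_right'
    have h1 : ∀ i, ∫⁻ ω, ∫⁻ x, F (S i (wordMap S n ω x)) ∂μ ∂(Measure.infinitePi fun _ : ℕ => P)
        = ∫⁻ x, F (S i x) ∂μ := by
      intro i
      have hFi : Measurable fun x => F (S i x) := hF.comp (hcont i).measurable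
      conv_rhs => rw [← ih, lintegral_map hFi (hm n)]
      exact (lintegral_prod _ (hFi.comp (hm n)).aemeasurable).symm
    rw [lintegral_map hF (hm _)]
    refine (lintegral_prod _ (hF.comp (hm (n + 1))).aemeasurable).trans ?_
    simp only [Function.comp_def]
    rw [lintegral_infinitePi_seqCons P (hlm (n + 1))]
    simp only [wordMap, seqShift_seqCons, seqCons_zero, h1]
    conv_rhs => rw [hμ]
    rw [lintegral_finsetSum_measure, lintegral_fintype]
    refine Finset.sum_congr rfl fun i _ => ?_
    rw [lintegral_smul_measure, lintegral_map hF (hcont i).measurable, smul_eq_mul, mul_comm]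

/-- The self-similar measure is the image of the Bernoulli measure under the coding map. -/
lemma map_coding [Nonempty E] (hcont : ∀ i, Continuous (S i))
    (hπ : ∀ ω x, Tendsto (fun n => wordMap S n ω x) atTop (𝓝 (π ω)))
    (hμ : μ = ∑ i, P {i} • μ.map (S i)) :
    (Measure.infinitePi fun _ : ℕ => P).map π = μ := by
  have hπm := measurable_coding hcont hπ
  have : IsProbabilityMeasure ((Measure.infinitePi fun _ : ℕ => P).map π) :=
    Measure.isProbabilityMeasure_map hπm.aemeasurable
  refine ext_of_forall_integral_eq_of_IsFiniteMeasure fun f => ?_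
  have hm := fun n => measurable_wordMap hcont (S := S) n
  have h1 : ∀ n, ∫ q, f (wordMap S n q.1 q.2) ∂((Measure.infinitePi fun _ : ℕ => P).prod μ)
      = ∫ x, f x ∂μ := by
    intro n
    conv_rhs => rw [← map_wordMap hcont hμ n]
    rw [integral_map (hm n).aemeasurable f.continuous.measurable.aestronglyMeasurable]
  have h2 : Tendsto (fun n => ∫ q, f (wordMap S n q.1 q.2)
      ∂((Measure.infinitePi fun _ : ℕ => P).prod μ)) atTop
      (𝓝 (∫ q, f (π q.1) ∂((Measure.infinitePi fun _ : ℕ => P).prod μ))) := by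
    refine tendsto_integral_of_dominated_convergence (fun _ => ‖f‖)
      (fun n => (f.continuous.measurable.comp (hm n)).aestronglyMeasurable)
      (integrable_const _) (fun n => Eventually.of_forall fun q => f.norm_coe_le_norm _)
      (Eventually.of_forall fun q => (f.continuous.tendsto _).comp (hπ q.1 q.2))
  simp only [h1] at h2
  rw [tendsto_nhds_unique tendsto_const_nhds h2,
    integral_map hπm.aemeasurable f.continuous.measurable.aestronglyMeasurable,
    integral_fun_fst (fun ω => f (π ω))]
  simp

end Coding

section LocalDimension

variable {E : Type*} [MetricSpace E] [MeasurableSpace E] [BorelSpace E] [Nonempty E]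
  {ℓ : ℕ} {S : Fin ℓ → E → E} {ρ : Fin ℓ → ℝ} {π : (ℕ → Fin ℓ) → E}
  {P : Measure (Fin ℓ)} [IsProbabilityMeasure P] {μ : Measure E} [IsProbabilityMeasure μ]

lemma lintegral_coding (hcont : ∀ i, Continuous (S i))
    (hπ : ∀ ω x, Tendsto (fun n => wordMap S n ω x) atTop (𝓝 (π ω)))
    (hμ : μ = ∑ i, P {i} • μ.map (S i)) {F : Fin ℓ → E → ENNReal} (hF : ∀ i, Measurable (F i)) :
    ∫⁻ ω, F (ω 0) (π ω) ∂(Measure.infinitePi fun _ : ℕ => P)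
      = ∑ i, ∫⁻ x, F i x ∂(P {i} • μ.map (S i)) := by
  have hπm := measurable_coding hcont hπ
  have hm : Measurable fun ω : ℕ → Fin ℓ => F (ω 0) (π ω) := by
    have h : Measurable fun q : Fin ℓ × E => F q.1 q.2 := measurable_from_prod_countable_right hF
    exact h.comp ((measurable_pi_apply 0).prodMk hπm)
  rw [lintegral_infinitePi_seqCons P hm, lintegral_fintype]
  refine Finset.sum_congr rfl fun i _ => ?_
  have hFi : Measurable fun x => F i (S i x) := (hF i).comp (hcont i).measurable
  rw [lintegral_smul_measure, lintegral_map (hF i) (hcont i).measurable, smul_eq_mul, mul_comm]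
  congr 1
  conv_rhs => rw [← map_coding hcont hπ hμ, lintegral_map hFi hπm]
  refine lintegral_congr fun ω => ?_
  rw [coding_eq hcont hπ (seqCons (i, ω))]
  simp

lemma measure_coding_mem_le (hcont : ∀ i, Continuous (S i))
    (hπ : ∀ ω x, Tendsto (fun n => wordMap S n ω x) atTop (𝓝 (π ω)))
    (hμ : μ = ∑ i, P {i} • μ.map (S i)) (A : Fin ℓ → Set E) :
    (Measure.infinitePi fun _ : ℕ => P) {ω | π ω ∈ A (ω 0)}
      ≤ ∑ i, (P {i} • μ.map (S i)) (A i) := by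
  set B : Fin ℓ → Set E := fun i => toMeasurable (P {i} • μ.map (S i)) (A i) with hB
  have hBm : ∀ i, MeasurableSet (B i) := fun i => measurableSet_toMeasurable _ _
  have h := lintegral_coding hcont hπ hμ (F := fun i => (B i).indicator 1)
    fun i => measurable_one.indicator (hBm i)
  simp only [lintegral_indicator_one (hBm _)] at h
  have hS : MeasurableSet {ω : ℕ → Fin ℓ | π ω ∈ B (ω 0)} := by
    have h : MeasurableSet {q : Fin ℓ × E | q.2 ∈ B q.1} := by
      refine measurableSet_setOfPred.2 (measurable_from_prod_countable_right fun i => ?_)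
      exact measurableSet_setOfPred.1 (hBm i)
    exact ((measurable_pi_apply 0).prodMk (measurable_coding hcont hπ)) h
  calc (Measure.infinitePi fun _ : ℕ => P) {ω | π ω ∈ A (ω 0)}
      ≤ (Measure.infinitePi fun _ : ℕ => P) {ω | π ω ∈ B (ω 0)} :=
        measure_mono fun ω hω => subset_toMeasurable _ _ hω
    _ = ∫⁻ ω, (B (ω 0)).indicator 1 (π ω) ∂(Measure.infinitePi fun _ : ℕ => P) := by
        rw [← lintegral_indicator_one hS]
        rfl
    _ = ∑ i, (P {i} • μ.map (S i)) (A i) := by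
        rw [h]
        exact Finset.sum_congr rfl fun i _ => measure_toMeasurable _

end LocalDimension

/-- The information `-log (ν (B̄(x, r)) / μ (B̄(x, r)))`. -/
noncomputable def ballInfo {E : Type*} [MetricSpace E] [MeasurableSpace E] (ν μ : Measure E)
    (x : E) (r : ℝ) : ENNReal :=
  ENNReal.ofReal (-Real.log (ν.real (Metric.closedBall x r) / μ.real (Metric.closedBall x r)))

lemma measure_closedBall_le_of_lt_ballInfo {E : Type*} [MetricSpace E]
    [MeasurableSpace E] {ν μ : Measure E} [IsFiniteMeasure ν]
    [IsFiniteMeasure μ] {x : E} {r : ℝ} {k : ℕ} (h : (k : ENNReal) < ballInfo ν μ x r) :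
    ν (Metric.closedBall x r)
      ≤ ENNReal.ofReal (Real.exp (-k)) * μ (Metric.closedBall x r) := by
  rw [ballInfo, ← ENNReal.ofReal_natCast, ENNReal.ofReal_lt_ofReal_iff_of_nonneg k.cast_nonneg]
    at h
  set u := ν.real (Metric.closedBall x r) with hu
  set v := μ.real (Metric.closedBall x r) with hv
  have hk : (0 : ℝ) ≤ k := k.cast_nonneg
  have hv0 : v ≠ 0 := by
    intro h0
    rw [h0, div_zero, Real.log_zero] at h
    linarith
  have hu0 : u ≠ 0 := by
    intro h0
    rw [h0, zero_div, Real.log_zero] at h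
    linarith
  have hvp : 0 < v := lt_of_le_of_ne measureReal_nonneg hv0.symm
  have hup : 0 < u := lt_of_le_of_ne measureReal_nonneg hu0.symm
  have h1 : u / v < Real.exp (-k) := by
    rw [← Real.log_lt_iff_lt_exp (div_pos hup hvp)]
    linarith
  rw [div_lt_iff₀ hvp] at h1
  rw [← ofReal_measureReal (μ := ν), ← ofReal_measureReal (μ := μ),
    ← ENNReal.ofReal_mul (Real.exp_nonneg _)]
  exact ENNReal.ofReal_le_ofReal h1.le

section Information

variable {E : Type*} [MetricSpace E] [SecondCountableTopology E] [MeasurableSpace E] [BorelSpace E]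

lemma measurable_ballInfo (ν μ : Measure E) [SFinite ν] [SFinite μ] :
    Measurable fun q : E × ℝ => ballInfo ν μ q.1 q.2 :=
  ((measurable_measure_closedBall ν).ennreal_toReal.div
    (measurable_measure_closedBall μ).ennreal_toReal).log.neg.ennreal_ofReal

lemma ae_tendsto_ballInfo [HasBesicovitchCovering E] (ν μ : Measure E) [IsFiniteMeasure ν]
    [IsFiniteMeasure μ] (hac : ν ≪ μ) :
    ∀ᵐ x ∂ν, Tendsto (fun r => ballInfo ν μ x r) (𝓝[>] 0)
      (𝓝 (ENNReal.ofReal (-Real.log (ν.rnDeriv μ x).toReal))) := by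
  filter_upwards [hac.ae_le (Besicovitch.ae_tendsto_rnDeriv ν μ), Measure.rnDeriv_pos hac,
    hac.ae_le (Measure.rnDeriv_lt_top ν μ)] with x hx hpos htop
  refine ENNReal.tendsto_ofReal (Tendsto.neg (Tendsto.log ?_ (ENNReal.toReal_pos hpos.ne' htop.ne).ne'))
  refine ((ENNReal.tendsto_toReal htop.ne).comp hx).congr fun r => ?_
  simp [ENNReal.toReal_div, measureReal_def]

lemma measurable_ballInfo_comp {ℓ : ℕ} {Ω : Type*} [MeasurableSpace Ω] (ν : Fin ℓ → Measure E)
    [∀ i, SFinite (ν i)] (μ : Measure E) [SFinite μ] {I : Ω → Fin ℓ} {X : Ω → E} {R : Ω → ℝ}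
    (hI : Measurable I) (hX : Measurable X) (hR : Measurable R) :
    Measurable fun ω => ballInfo (ν (I ω)) μ (X ω) (R ω) := by
  have h : Measurable fun q : Fin ℓ × (E × ℝ) => ballInfo (ν q.1) μ q.2.1 q.2.2 :=
    measurable_from_prod_countable_right fun i => measurable_ballInfo (ν i) μ
  have k : Measurable fun ω => (I ω, X ω, R ω) := hI.prodMk (hX.prodMk hR)
  have hc := h.comp k
  exact hc

end Information

lemma smul_map_le_of_eq_sum {E : Type*} [MeasurableSpace E] {ℓ : ℕ} {S : Fin ℓ → E → E}
    {P : Measure (Fin ℓ)} {μ : Measure E} (hμ : μ = ∑ i, P {i} • μ.map (S i)) (i : Fin ℓ) :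
    P {i} • μ.map (S i) ≤ μ := by
  conv_rhs => rw [hμ]
  exact Finset.single_le_sum (f := fun i => P {i} • μ.map (S i)) (fun _ _ => Measure.zero_le _)
    (Finset.mem_univ i)

section InfoSup

variable {E : Type*} [MetricSpace E] [SecondCountableTopology E] [HasBesicovitchCovering E]
  [MeasurableSpace E] [BorelSpace E] [Nonempty E]
  {ℓ : ℕ} {S : Fin ℓ → E → E} {π : (ℕ → Fin ℓ) → E}
  {P : Measure (Fin ℓ)} [IsProbabilityMeasure P] {μ : Measure E} [IsProbabilityMeasure μ]

lemma lintegral_iSup_ballInfo_lt_top (hcont : ∀ i, Continuous (S i))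
    (hπ : ∀ ω x, Tendsto (fun n => wordMap S n ω x) atTop (𝓝 (π ω)))
    (hμ : μ = ∑ i, P {i} • μ.map (S i)) {R : ℕ → (ℕ → Fin ℓ) → ℝ} (hR : ∀ n, Measurable (R n))
    (hR0 : ∀ n ω, 0 < R n ω) {c : ℝ} (hRc : ∀ n ω, R n ω ≤ c) :
    ∫⁻ ω, ⨆ n, ballInfo (P {ω 0} • μ.map (S (ω 0))) μ (π ω) (R n ω)
      ∂(Measure.infinitePi fun _ : ℕ => P) < ⊤ := by
  obtain ⟨N, hN⟩ := exists_measure_closedBall_le_mul_le E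
  have hfinν : ∀ i, IsFiniteMeasure (P {i} • μ.map (S i)) := fun i =>
    isFiniteMeasure_of_le μ (smul_map_le_of_eq_sum hμ i)
  have hm : Measurable fun ω => ⨆ n, ballInfo (P {ω 0} • μ.map (S (ω 0))) μ (π ω) (R n ω) :=
    Measurable.iSup fun n => measurable_ballInfo_comp
      (fun i => P {i} • μ.map (S i)) μ (measurable_pi_apply 0) (measurable_coding hcont hπ) (hR n)
  refine (lintegral_le_tsum_measure_natCast_lt _ hm).trans_lt ?_
  have hk : ∀ k : ℕ, (Measure.infinitePi fun _ : ℕ => P)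
      {ω | (k : ENNReal) < ⨆ n, ballInfo (P {ω 0} • μ.map (S (ω 0))) μ (π ω) (R n ω)}
      ≤ (ℓ * N : ℕ) * ENNReal.ofReal (Real.exp (-1)) ^ k := by
    intro k
    set A : Fin ℓ → Set E := fun i => {x | ∃ r, 0 < r ∧ r ≤ c ∧
      (P {i} • μ.map (S i)) (Metric.closedBall x r)
        ≤ ENNReal.ofReal (Real.exp (-k)) * μ (Metric.closedBall x r)} with hA
    calc _ ≤ (Measure.infinitePi fun _ : ℕ => P) {ω | π ω ∈ A (ω 0)} := by
          refine measure_mono fun ω hω => ?_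
          obtain ⟨n, hn⟩ := lt_iSup_iff.1 (Set.mem_ofPred_eq ▸ hω)
          exact ⟨R n ω, hR0 n ω, hRc n ω, measure_closedBall_le_of_lt_ballInfo hn⟩
      _ ≤ ∑ i, (P {i} • μ.map (S i)) (A i) := measure_coding_mem_le hcont hπ hμ A
      _ ≤ ∑ i : Fin ℓ, (N : ENNReal) * (ENNReal.ofReal (Real.exp (-k)) * μ Set.univ) :=
          Finset.sum_le_sum fun i _ => hN μ _ _ _
      _ = _ := by
          rw [← ENNReal.ofReal_pow (Real.exp_nonneg _), ← Real.exp_nat_mul]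
          simp [mul_assoc]
  refine (ENNReal.tsum_le_tsum hk).trans_lt ?_
  rw [ENNReal.tsum_mul_left, ENNReal.tsum_geometric]
  refine ENNReal.mul_lt_top (ENNReal.natCast_lt_top _) (ENNReal.inv_lt_top.2 ?_)
  rw [tsub_pos_iff_lt, ENNReal.ofReal_lt_one]
  exact Real.exp_lt_one_iff.2 (by norm_num)

lemma exists_lintegral_iSup_ballInfo_lt (hcont : ∀ i, Continuous (S i))
    (hπ : ∀ ω x, Tendsto (fun n => wordMap S n ω x) atTop (𝓝 (π ω)))
    (hμ : μ = ∑ i, P {i} • μ.map (S i)) {R : ℕ → (ℕ → Fin ℓ) → ℝ} (hR : ∀ n, Measurable (R n))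
    (hR0 : ∀ n ω, 0 < R n ω) {c : ℝ} (hRc : ∀ n ω, R n ω ≤ c)
    (hRlim : ∀ ω, Tendsto (fun n => R n ω) atTop (𝓝 0)) {h : ENNReal}
    (hh : ∑ i, ∫⁻ x, ENNReal.ofReal (-Real.log ((P {i} • μ.map (S i)).rnDeriv μ x).toReal)
      ∂(P {i} • μ.map (S i)) < h) :
    ∃ N, ∫⁻ ω, ⨆ n, ballInfo (P {ω 0} • μ.map (S (ω 0))) μ (π ω) (R (n + N) ω)
      ∂(Measure.infinitePi fun _ : ℕ => P) < h := by
  set m := Measure.infinitePi fun _ : ℕ => P with hm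
  set ν : Fin ℓ → Measure E := fun i => P {i} • μ.map (S i) with hν
  have hle : ∀ i, ν i ≤ μ := smul_map_le_of_eq_sum hμ
  have hfinν : ∀ i, IsFiniteMeasure (ν i) := fun i => isFiniteMeasure_of_le μ (hle i)
  set G : ℕ → (ℕ → Fin ℓ) → ENNReal := fun n ω => ballInfo (ν (ω 0)) μ (π ω) (R n ω) with hG
  have hGm : ∀ n, Measurable (G n) := fun n => measurable_ballInfo_comp
      (fun i => P {i} • μ.map (S i)) μ (measurable_pi_apply 0) (measurable_coding hcont hπ) (hR n)
  have hlim : ∀ᵐ ω ∂m, Tendsto (fun n => G n ω) atTop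
      (𝓝 (ENNReal.ofReal (-Real.log ((ν (ω 0)).rnDeriv μ (π ω)).toReal))) := by
    have h0 : m {ω | π ω ∈ (fun i => {x | ¬ Tendsto (fun r => ballInfo (ν i) μ x r) (𝓝[>] 0)
        (𝓝 (ENNReal.ofReal (-Real.log ((ν i).rnDeriv μ x).toReal)))}) (ω 0)} = 0 := by
      refine le_antisymm ((measure_coding_mem_le hcont hπ hμ fun i => {x | ¬ Tendsto
        (fun r => ballInfo (ν i) μ x r) (𝓝[>] 0)
        (𝓝 (ENNReal.ofReal (-Real.log ((ν i).rnDeriv μ x).toReal)))}).trans_eq ?_) zero_le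
      exact Finset.sum_eq_zero fun i _ => ae_iff.1
        (ae_tendsto_ballInfo (ν i) μ (Measure.absolutelyContinuous_of_le (hle i)))
    filter_upwards [measure_eq_zero_iff_ae_notMem.1 h0] with ω hω
    exact (not_not.1 hω).comp (tendsto_nhdsWithin_iff.2
      ⟨hRlim ω, Eventually.of_forall fun n => hR0 n ω⟩)
  have hanti : Antitone fun N ω => ⨆ n, G (n + N) ω := by
    intro a b hab ω
    refine iSup_le fun n => ?_
    have : n + b = (n + (b - a)) + a := by omega
    rw [this]
    exact le_iSup (fun n => G (n + a) ω) _
  have hHm : ∀ N, Measurable fun ω => ⨆ n, G (n + N) ω := fun N =>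
    Measurable.iSup fun n => hGm _
  have hfin : ∫⁻ ω, ⨆ n, G (n + 0) ω ∂m ≠ ⊤ :=
    (lintegral_iSup_ballInfo_lt_top hcont hπ hμ hR hR0 hRc).ne
  have hinf : ⨅ N, ∫⁻ ω, ⨆ n, G (n + N) ω ∂m < h := by
    rw [← lintegral_iInf hHm hanti hfin]
    refine lt_of_eq_of_lt ?_ hh
    rw [← lintegral_coding hcont hπ hμ (F := fun i x =>
      ENNReal.ofReal (-Real.log ((ν i).rnDeriv μ x).toReal)) fun i =>
        (Measure.measurable_rnDeriv _ _).ennreal_toReal.log.neg.ennreal_ofReal]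
    refine lintegral_congr_ae ?_
    filter_upwards [hlim] with ω hω
    rw [← hω.limsup_eq, limsup_eq_iInf_iSup_of_nat']
  exact iInf_lt_iff.1 hinf

end InfoSup

lemma measurable_wordRatio {ℓ : ℕ} (ρ : Fin ℓ → ℝ) (n : ℕ) :
    Measurable fun ω : ℕ → Fin ℓ => wordRatio ρ n ω := by
  induction n with
  | zero => exact measurable_const
  | succ n ih =>
    have h : Measurable ρ := measurable_of_finite ρ
    exact (h.comp (measurable_pi_apply 0)).mul (ih.comp measurable_seqShift)

section Scaling

variable {E : Type*} [MetricSpace E] [MeasurableSpace E] [BorelSpace E]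
  {ℓ : ℕ} {S : Fin ℓ → E → E} {ρ : Fin ℓ → ℝ} {π : (ℕ → Fin ℓ) → E}
  {P : Measure (Fin ℓ)} {μ : Measure E}

lemma map_similarity_closedBall {S : E → E} {ρ : ℝ} (hρ : 0 < ρ)
    (hS : ∀ x y, dist (S x) (S y) = ρ * dist x y) (y : E) (t : ℝ) :
    μ.map S (Metric.closedBall (S y) (ρ * t)) = μ (Metric.closedBall y t) := by
  have hcont : Continuous S :=
    (LipschitzWith.of_dist_le_mul (K := ⟨ρ, hρ.le⟩) fun x y => (hS x y).le).continuous
  rw [Measure.map_apply hcont.measurable Metric.isClosed_closedBall.measurableSet]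
  congr 1
  ext z
  simp [hS, mul_le_mul_iff_right₀ hρ]

lemma smul_map_real_closedBall_coding [Nonempty E] (hρ0 : ∀ i, 0 < ρ i)
    (hS : ∀ i x y, dist (S i x) (S i y) = ρ i * dist x y) (hcont : ∀ i, Continuous (S i))
    (hπ : ∀ ω x, Tendsto (fun n => wordMap S n ω x) atTop (𝓝 (π ω))) (c : ℝ) (n : ℕ)
    (ω : ℕ → Fin ℓ) :
    (P {ω 0} • μ.map (S (ω 0))).real (Metric.closedBall (π ω) (c * wordRatio ρ (n + 1) ω))
      = P.real {ω 0} * μ.real (Metric.closedBall (π (seqShift ω))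
          (c * wordRatio ρ n (seqShift ω))) := by
  rw [coding_eq hcont hπ ω, wordRatio, mul_left_comm, measureReal_ennreal_smul_apply,
    measureReal_def, map_similarity_closedBall (hρ0 _) (hS _)]
  rfl

lemma pow_le_measure_closedBall_coding [Nonempty E] [IsProbabilityMeasure P]
    [IsProbabilityMeasure μ] (hρ0 : ∀ i, 0 < ρ i)
    (hS : ∀ i x y, dist (S i x) (S i y) = ρ i * dist x y) (hcont : ∀ i, Continuous (S i))
    (hπ : ∀ ω x, Tendsto (fun n => wordMap S n ω x) atTop (𝓝 (π ω)))
    (hμ : μ = ∑ i, P {i} • μ.map (S i)) {c : ℝ} (hc : ∀ ω ω', dist (π ω) (π ω') ≤ c)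
    {b : ℝ} (hb0 : 0 ≤ b) (hb : ∀ i, b ≤ P.real {i}) (n : ℕ) (ω : ℕ → Fin ℓ) :
    b ^ n ≤ μ.real (Metric.closedBall (π ω) (c * wordRatio ρ n ω)) := by
  induction n generalizing ω with
  | zero =>
    have h : μ (Metric.closedBall (π ω) c) = 1 := by
      conv_lhs => rw [← map_coding hcont hπ hμ]
      rw [Measure.map_apply (measurable_coding hcont hπ) Metric.isClosed_closedBall.measurableSet]
      rw [Set.eq_univ_of_forall (s := π ⁻¹' Metric.closedBall (π ω) c) fun ω' => hc ω' ω]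
      exact measure_univ
    simp [wordRatio, measureReal_def, h]
  | succ n ih =>
    rw [pow_succ']
    calc b * b ^ n
        ≤ P.real {ω 0} * μ.real (Metric.closedBall (π (seqShift ω))
          (c * wordRatio ρ n (seqShift ω))) :=
          mul_le_mul (hb _) (ih _) (pow_nonneg hb0 n) measureReal_nonneg
      _ = _ := (smul_map_real_closedBall_coding hρ0 hS hcont hπ c n ω).symm
      _ ≤ _ := ENNReal.toReal_mono (measure_ne_top _ _) (smul_map_le_of_eq_sum hμ _ _)

end Scaling

section Birkhoff

variable {E : Type*} [MetricSpace E] [SecondCountableTopology E] [HasBesicovitchCovering E]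
  [MeasurableSpace E] [BorelSpace E] [Nonempty E]
  {ℓ : ℕ} {S : Fin ℓ → E → E} {ρ : Fin ℓ → ℝ} {π : (ℕ → Fin ℓ) → E}
  {P : Measure (Fin ℓ)} [IsProbabilityMeasure P] {μ : Measure E} [IsProbabilityMeasure μ]

lemma integral_infinitePi_comp_zero (g : Fin ℓ → ℝ) :
    Integrable (fun ω : ℕ → Fin ℓ => g (ω 0)) (Measure.infinitePi fun _ : ℕ => P) ∧
    ∫ ω, g (ω 0) ∂(Measure.infinitePi fun _ : ℕ => P) = ∑ i, P.real {i} * g i := by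
  have hmp : MeasurePreserving (fun ω : ℕ → Fin ℓ => ω 0) (Measure.infinitePi fun _ : ℕ => P) P :=
    ⟨measurable_pi_apply 0, Measure.infinitePi_map_eval (fun _ : ℕ => P) 0⟩
  have hi : Integrable g P := Integrable.of_finite
  refine ⟨hmp.integrable_comp_of_integrable hi, ?_⟩
  calc ∫ ω, g (ω 0) ∂(Measure.infinitePi fun _ : ℕ => P)
      = ∫ i, g i ∂((Measure.infinitePi fun _ : ℕ => P).map fun ω => ω 0) :=
        (integral_map hmp.measurable.aemeasurable
          (measurable_of_finite g).aestronglyMeasurable).symm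
    _ = ∑ i, P.real {i} * g i := by rw [hmp.map_eq, integral_fintype hi]; rfl

lemma ae_exists_log_measure_closedBall_le (hρ0 : ∀ i, 0 < ρ i) {θ : ℝ} (hθ1 : θ < 1)
    (hρθ : ∀ i, ρ i ≤ θ) (hS : ∀ i x y, dist (S i x) (S i y) = ρ i * dist x y)
    (hcont : ∀ i, Continuous (S i))
    (hπ : ∀ ω x, Tendsto (fun n => wordMap S n ω x) atTop (𝓝 (π ω)))
    (hμ : μ = ∑ i, P {i} • μ.map (S i)) (hP : ∀ i, 0 < P.real {i})
    {c : ℝ} (hc : 0 < c) (hpos : ∀ n ω, 0 < μ.real (Metric.closedBall (π ω) (c * wordRatio ρ n ω)))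
    {s : ℝ} (hs : ∑ i, ∫⁻ x, ENNReal.ofReal (-Real.log ((P {i} • μ.map (S i)).rnDeriv μ x).toReal)
      ∂(P {i} • μ.map (S i))
        < ENNReal.ofReal (-∑ i, P.real {i} * (Real.log (P.real {i}) - s * Real.log (ρ i)))) :
    ∃ N, ∀ᵐ ω ∂(Measure.infinitePi fun _ : ℕ => P), ∃ C, ∀ n,
      Real.log (μ.real (Metric.closedBall (π ω) (c * wordRatio ρ (n + N) ω)))
        ≤ C + s * Real.log (wordRatio ρ n ω) := by
  set m := Measure.infinitePi fun _ : ℕ => P with hm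
  have hθ0 : 0 ≤ θ := by
    have : Nonempty (Fin ℓ) := by
      by_contra h
      rw [not_nonempty_iff] at h
      have : IsEmpty (ℕ → Fin ℓ) := inferInstance
      exact NeZero.ne m (Measure.eq_zero_of_isEmpty m)
    exact (hρ0 this.some).le.trans (hρθ _)
  have hRm : ∀ n, Measurable fun ω : ℕ → Fin ℓ => c * wordRatio ρ n ω := fun n =>
    (measurable_wordRatio ρ n).const_mul c
  have hR0 : ∀ n (ω : ℕ → Fin ℓ), 0 < c * wordRatio ρ n ω := fun n ω =>
    mul_pos hc (wordRatio_pos hρ0 n ω)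
  obtain ⟨N, hN⟩ := exists_lintegral_iSup_ballInfo_lt hcont hπ hμ hRm hR0 (c := c)
    (fun n ω => mul_le_of_le_one_right hc.le
      ((wordRatio_le_pow hρ0 hρθ n ω).trans (pow_le_one₀ hθ0 hθ1.le)))
    (fun ω => squeeze_zero (fun n => (hR0 n ω).le)
      (fun n => mul_le_mul_of_nonneg_left (wordRatio_le_pow hρ0 hρθ n ω) hc.le)
      (by simpa using (tendsto_pow_atTop_nhds_zero_of_lt_one hθ0 hθ1).const_mul c)) hs
  refine ⟨N, ?_⟩
  have hfinν : ∀ i, IsFiniteMeasure (P {i} • μ.map (S i)) := fun i =>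
    isFiniteMeasure_of_le μ (smul_map_le_of_eq_sum hμ i)
  set H : (ℕ → Fin ℓ) → ENNReal := fun ω => ⨆ n, ballInfo (P {ω 0} • μ.map (S (ω 0))) μ (π ω)
    (c * wordRatio ρ (n + N) ω) with hH
  have hHm : Measurable H := Measurable.iSup fun n => measurable_ballInfo_comp
      (fun i => P {i} • μ.map (S i)) μ (measurable_pi_apply 0) (measurable_coding hcont hπ) (hRm _)
  have hHfin : ∀ᵐ ω ∂m, H ω < ⊤ := ae_lt_top hHm hN.ne_top
  have hHi : Integrable (fun ω => (H ω).toReal) m :=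
    integrable_toReal_of_lintegral_ne_top hHm.aemeasurable hN.ne_top
  set g : Fin ℓ → ℝ := fun i => Real.log (P.real {i}) - s * Real.log (ρ i) with hg
  obtain ⟨hgi, hgint⟩ := integral_infinitePi_comp_zero (P := P) g
  set f : (ℕ → Fin ℓ) → ℝ := fun ω => g (ω 0) + (H ω).toReal with hf
  have hneg : ∫ ω, f ω ∂m < 0 := by
    rw [integral_add hgi hHi, hgint, integral_toReal hHm.aemeasurable hHfin]
    have h1 : 0 < -∑ i, P.real {i} * g i := by
      by_contra h
      rw [ENNReal.ofReal_of_nonpos (not_lt.1 h)] at hN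
      exact not_lt_zero hN
    have h2 := (ENNReal.toReal_lt_toReal hN.ne_top ENNReal.ofReal_ne_top).2 hN
    rw [ENNReal.toReal_ofReal h1.le] at h2
    linarith
  have hfm : Measurable f :=
    ((measurable_of_finite g).comp (measurable_pi_apply 0)).add hHm.ennreal_toReal
  have hshift : ∀ᵐ ω ∂m, ∀ k, H (seqShift^[k] ω) < ⊤ := ae_all_iff.2 fun k =>
    ((measurePreserving_seqShift P).iterate k).quasiMeasurePreserving.ae hHfin
  filter_upwards [(ergodic_seqShift P).ae_exists_birkhoffSum_le hfm (hgi.add hHi) hneg, hshift]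
    with ω hω hfinω
  obtain ⟨C, hC⟩ := hω
  refine ⟨C, fun n => ?_⟩
  refine le_trans ?_ (add_le_add (hC n) le_rfl)
  clear hC
  induction n generalizing ω with
  | zero =>
    simpa [wordRatio] using Real.log_nonpos measureReal_nonneg measureReal_le_one
  | succ n ih =>
    have h0 : H ω < ⊤ := hfinω 0
    have h1 := ih (seqShift ω) fun k => hfinω (k + 1)
    have h2 : ballInfo (P {ω 0} • μ.map (S (ω 0))) μ (π ω) (c * wordRatio ρ (n + N + 1) ω)
        ≤ H ω := by
      have := le_iSup (fun n => ballInfo (P {ω 0} • μ.map (S (ω 0))) μ (π ω)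
        (c * wordRatio ρ (n + N) ω)) (n + 1)
      rwa [Nat.add_right_comm] at this
    have h3 := hpos (n + N + 1) ω
    have h4 := hpos (n + N) (seqShift ω)
    rw [ballInfo, smul_map_real_closedBall_coding hρ0 hS hcont hπ,
      ENNReal.ofReal_le_iff_le_toReal h0.ne, Real.log_div (mul_pos (hP _) h4).ne' h3.ne',
      Real.log_mul (hP _).ne' h4.ne'] at h2
    have h5 : Real.log (wordRatio ρ (n + 1) ω)
        = Real.log (ρ (ω 0)) + Real.log (wordRatio ρ n (seqShift ω)) :=
      Real.log_mul (hρ0 _).ne' (wordRatio_pos hρ0 _ _).ne'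
    rw [Nat.add_right_comm, birkhoffSum_succ', h5]
    simp only [hf, hg]
    linarith

end Birkhoff

lemma isCoboundedUnder_log_measure_div_log {E : Type*} [MetricSpace E] [MeasurableSpace E]
    {μ : Measure E} {x : E} {b θ c : ℝ} (hb0 : 0 < b) (hb1 : b < 1) (hθ0 : 0 < θ)
    (hθ1 : θ < 1) (hc : 0 < c) (hlow : ∀ n, b ^ n ≤ μ.real (Metric.closedBall x (c * θ ^ n))) :
    IsCoboundedUnder (· ≥ ·) (𝓝[>] 0)
      fun r : ℝ => Real.log (μ.real (Metric.closedBall x r)) / Real.log r := by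
  have hlim : Tendsto (fun n : ℕ => c * θ ^ n) atTop (𝓝[>] 0) := by
    refine tendsto_nhdsWithin_iff.2 ⟨?_, Eventually.of_forall fun n => mul_pos hc (pow_pos hθ0 n)⟩
    simpa using (tendsto_pow_atTop_nhds_zero_of_lt_one hθ0.le hθ1).const_mul c
  have hlogb := Real.log_neg hb0 hb1
  have hlogθ := Real.log_neg hθ0 hθ1
  set M := 2 * Real.log b / Real.log θ with hM
  have hev : ∀ᶠ n : ℕ in atTop, M * Real.log c + n * Real.log b ≤ 0 := by
    have : Tendsto (fun n : ℕ => (n : ℝ) * Real.log b) atTop atBot :=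
      tendsto_natCast_atTop_atTop.atTop_mul_const_of_neg hlogb
    filter_upwards [this.eventually_le_atBot (-(M * Real.log c))] with n hn
    linarith
  have hlt : ∀ᶠ r : ℝ in 𝓝[>] 0, r < 1 :=
    mem_nhdsWithin_of_mem_nhds (Iio_mem_nhds one_pos)
  refine IsCoboundedUnder.of_frequently_le (a := M) (hlim.frequently (Eventually.frequently ?_))
  filter_upwards [hev, hlim.eventually hlt] with n hn hn1
  have hr0 : 0 < c * θ ^ n := mul_pos hc (pow_pos hθ0 n)
  rw [div_le_iff_of_neg (Real.log_neg hr0 hn1)]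
  have h1 : n * Real.log b ≤ Real.log (μ.real (Metric.closedBall x (c * θ ^ n))) := by
    rw [← Real.log_pow]
    exact Real.log_le_log (pow_pos hb0 n) (hlow n)
  have h2 : M * Real.log θ = 2 * Real.log b := div_mul_cancel₀ _ hlogθ.ne
  rw [Real.log_mul hc.ne' (pow_pos hθ0 n).ne', Real.log_pow]
  have h3 : M * (Real.log c + n * Real.log θ) = M * Real.log c + n * (2 * Real.log b) := by
    rw [← h2]; ring
  linarith

section LocalDimensionBounds

variable {E : Type*} [MetricSpace E] [MeasurableSpace E] {μ : Measure E} [IsProbabilityMeasure μ]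
  {x : E}

lemma exists_measure_closedBall_le_rpow {R : ℕ → ℝ} (hR0 : R 0 = 1) (hRpos : ∀ n, 0 < R n)
    (hRlim : Tendsto R atTop (𝓝 0)) {b : ℝ} (hb0 : 0 < b) (hb1 : b ≤ 1)
    (hRb : ∀ n k, R n * b ^ k ≤ R (n + k)) {c : ℝ} (hc : 0 < c)
    (hpos : ∀ n, 0 < μ.real (Metric.closedBall x (c * R n))) {s : ℝ} (hs : 0 ≤ s) {C : ℝ} {N : ℕ}
    (h : ∀ n, Real.log (μ.real (Metric.closedBall x (c * R (n + N)))) ≤ C + s * Real.log (R n)) :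
    ∃ K : ℕ, ∀ q, 0 < q → μ.real (Metric.closedBall x q) ≤ K * q ^ s := by
  set D := c * b ^ (N + 1) with hD
  have hD0 : 0 < D := mul_pos hc (pow_pos hb0 _)
  obtain ⟨K, hK⟩ := exists_nat_ge (max 1 (Real.exp C) * (D ^ s)⁻¹)
  refine ⟨K, fun q hq => ?_⟩
  suffices hmain : μ.real (Metric.closedBall x q) ≤ max 1 (Real.exp C) * (q / D) ^ s by
    refine hmain.trans ?_
    rw [Real.div_rpow hq.le hD0.le, div_eq_mul_inv, mul_comm (q ^ s), ← mul_assoc]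
    exact mul_le_mul_of_nonneg_right hK (Real.rpow_nonneg hq.le _)
  have hex : ∃ n, c * R (n + N) < q := by
    have : Tendsto (fun n => c * R (n + N)) atTop (𝓝 0) := by
      simpa using (hRlim.comp (tendsto_add_atTop_nat N)).const_mul c
    exact (this.eventually_lt_const hq).exists
  have hfind := Nat.find_spec hex
  rcases hn : Nat.find hex with _ | n
  · rw [hn, zero_add] at hfind
    have h1 : 1 ≤ q / D := by
      rw [one_le_div hD0]
      refine le_trans (mul_le_mul_of_nonneg_left ?_ hc.le) hfind.le
      calc b ^ (N + 1) ≤ b ^ N := pow_le_pow_of_le_one hb0.le hb1 (Nat.le_succ N)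
        _ ≤ R N := by simpa [hR0] using hRb 0 N
    calc μ.real (Metric.closedBall x q) ≤ 1 * 1 := by simp
      _ ≤ _ := mul_le_mul (le_max_left _ _) (Real.one_le_rpow h1 hs) zero_le_one
          (zero_le_one.trans (le_max_left _ _))
  · rw [hn] at hfind
    have hq' : q ≤ c * R (n + N) := not_lt.1 (Nat.find_min hex (m := n) (by omega))
    have h1 : R n ≤ q / D := by
      rw [le_div_iff₀ hD0]
      have := mul_le_mul_of_nonneg_left (hRb n (N + 1)) hc.le
      rw [show n + (N + 1) = n + 1 + N by ring] at this
      rw [hD]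
      nlinarith
    calc μ.real (Metric.closedBall x q) ≤ μ.real (Metric.closedBall x (c * R (n + N))) :=
          measureReal_mono (Metric.closedBall_subset_closedBall hq')
      _ = Real.exp (Real.log (μ.real (Metric.closedBall x (c * R (n + N))))) :=
          (Real.exp_log (hpos _)).symm
      _ ≤ Real.exp (C + s * Real.log (R n)) := Real.exp_le_exp.2 (h n)
      _ = Real.exp C * R n ^ s := by
          rw [Real.exp_add, Real.rpow_def_of_pos (hRpos n), mul_comm s]
      _ ≤ max 1 (Real.exp C) * (q / D) ^ s :=
          mul_le_mul (le_max_right _ _) (Real.rpow_le_rpow (hRpos n).le h1 hs)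
            (Real.rpow_nonneg (hRpos n).le _) (zero_le_one.trans (le_max_left _ _))

lemma le_liminf_log_measure_div_log {b θ c : ℝ} (hb0 : 0 < b) (hb1 : b < 1) (hθ0 : 0 < θ)
    (hθ1 : θ < 1) (hc : 0 < c) (hlow : ∀ n, b ^ n ≤ μ.real (Metric.closedBall x (c * θ ^ n)))
    {s : ℝ} (hup : ∀ t : ℚ, 0 ≤ t → t < s → ∃ K : ℕ, ∀ q : ℚ, 0 < q →
      μ.real (Metric.closedBall x q) ≤ K * (q : ℝ) ^ (t : ℝ)) :
    s ≤ liminf (fun r : ℝ => Real.log (μ.real (Metric.closedBall x r)) / Real.log r) (𝓝[>] 0) := by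
  refine le_of_forall_lt_imp_le_of_dense fun a has => le_liminf_of_le
    (isCoboundedUnder_log_measure_div_log hb0 hb1 hθ0 hθ1 hc hlow) ?_
  have hlt : ∀ᶠ r : ℝ in 𝓝[>] 0, r < 1 :=
    mem_nhdsWithin_of_mem_nhds (Iio_mem_nhds one_pos)
  rcases lt_or_ge a 0 with ha | ha
  · filter_upwards [hlt, self_mem_nhdsWithin] with r hr1 hr0
    exact ha.le.trans (div_nonneg_of_nonpos
      (Real.log_nonpos measureReal_nonneg measureReal_le_one) (Real.log_nonpos (le_of_lt hr0) hr1.le))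
  obtain ⟨t, hat, hts⟩ := exists_rat_btwn has
  have ht0 : (0 : ℝ) ≤ t := ha.trans hat.le
  obtain ⟨K, hK⟩ := hup t (by exact_mod_cast ht0) hts
  have hta : 0 < (t : ℝ) - a := sub_pos.2 hat
  have hlog := Real.tendsto_log_nhdsGT_zero.eventually_le_atBot
    (-((Real.log K + t * Real.log 2) / (t - a)))
  filter_upwards [hlt, self_mem_nhdsWithin, hlog] with r hr1 hr0 hr
  replace hr0 : 0 < r := hr0
  rw [le_div_iff_of_neg (Real.log_neg hr0 hr1)]
  have hpos : 0 < μ.real (Metric.closedBall x r) := by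
    have : ∃ n, c * θ ^ n < r := by
      have h0 : Tendsto (fun n => c * θ ^ n) atTop (𝓝 0) := by
        simpa using (tendsto_pow_atTop_nhds_zero_of_lt_one hθ0.le hθ1).const_mul c
      exact (h0.eventually_lt_const hr0).exists
    obtain ⟨n, hn⟩ := this
    exact (pow_pos hb0 n).trans_le ((hlow n).trans
      (measureReal_mono (Metric.closedBall_subset_closedBall hn.le)))
  obtain ⟨q, hrq, hq2⟩ := exists_rat_btwn (show r < 2 * r by linarith)
  have hle : μ.real (Metric.closedBall x r) ≤ K * (2 * r) ^ (t : ℝ) :=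
    calc _ ≤ μ.real (Metric.closedBall x q) :=
          measureReal_mono (Metric.closedBall_subset_closedBall hrq.le)
      _ ≤ K * (q : ℝ) ^ (t : ℝ) := hK q (by exact_mod_cast hr0.trans hrq)
      _ ≤ _ := mul_le_mul_of_nonneg_left
          (Real.rpow_le_rpow (hr0.trans hrq).le hq2.le ht0) K.cast_nonneg
  have hp : 0 < (2 * r) ^ (t : ℝ) := Real.rpow_pos_of_pos (by linarith) _
  have hK0 : (0 : ℝ) < K := pos_of_mul_pos_left (hpos.trans_le hle) hp.le
  have hle' := Real.log_le_log hpos hle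
  rw [Real.log_mul hK0.ne' hp.ne', Real.log_rpow (by linarith), Real.log_mul two_ne_zero hr0.ne']
    at hle'
  have h1 : (t - a) * Real.log r ≤ -(Real.log K + t * Real.log 2) := by
    rw [← neg_div, le_div_iff₀ hta] at hr
    linarith
  linarith

end LocalDimensionBounds

/-- The total conditional information of the pieces `ν i` of `μ` is at most that of any finite
cover. -/
lemma sum_lintegral_neg_log_rnDeriv_le {E : Type*} [MeasurableSpace E] {ℓ : ℕ} {μ : Measure E}
    [IsFiniteMeasure μ] {ν : Fin ℓ → Measure E} (hμ : μ = ∑ i, ν i) (𝒟 : Finset (Set E))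
    (hcov : ∀ᵐ x ∂μ, x ∈ ⋃ D ∈ 𝒟, D) :
    0 ≤ ∑ D ∈ 𝒟, fEnt (fun i => (ν i).real D) ∧
    ∑ i, ∫⁻ x, ENNReal.ofReal (-Real.log ((ν i).rnDeriv μ x).toReal) ∂(ν i)
      ≤ ENNReal.ofReal (∑ D ∈ 𝒟, fEnt fun i => (ν i).real D) := by
  have hle : ∀ i, ν i ≤ μ := by
    intro i
    conv_rhs => rw [hμ]
    exact Finset.single_le_sum (f := ν) (fun _ _ => Measure.zero_le _) (Finset.mem_univ i)
  have hfin : ∀ i, IsFiniteMeasure (ν i) := fun i => isFiniteMeasure_of_le μ (hle i)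
  have hsum : ∀ D, ∑ i, (ν i).real D = μ.real D := by
    intro D
    simp only [measureReal_def]
    rw [← ENNReal.toReal_sum fun i _ => measure_ne_top _ _]
    congr 1
    conv_rhs => rw [hμ]
    simp
  have hterm : ∀ i D, 0 ≤ phi ((ν i).real D) + (ν i).real D * Real.log (μ.real D) := by
    intro i D
    rcases (measureReal_nonneg (μ := ν i) (s := D)).eq_or_lt with h0 | h0
    · simp [← h0, phi]
    · have h1 : (ν i).real D ≤ μ.real D := ENNReal.toReal_mono (measure_ne_top _ _) (hle i D)
      have h2 := mul_le_mul_of_nonneg_left (Real.log_le_log h0 h1) h0.le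
      rw [phi]
      linarith
  have hent : ∑ D ∈ 𝒟, fEnt (fun i => (ν i).real D)
      = ∑ i, ∑ D ∈ 𝒟, (phi ((ν i).real D) + (ν i).real D * Real.log (μ.real D)) := by
    rw [Finset.sum_comm]
    refine Finset.sum_congr rfl fun D _ => ?_
    rw [Finset.sum_add_distrib, ← Finset.sum_mul, fEnt, hsum, phi, sub_neg_eq_add]
  have hnn : ∀ i, 0 ≤ ∑ D ∈ 𝒟, (phi ((ν i).real D) + (ν i).real D * Real.log (μ.real D)) :=
    fun i => Finset.sum_nonneg fun D _ => hterm i D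
  rw [hent]
  refine ⟨Finset.sum_nonneg fun i _ => hnn i, ?_⟩
  rw [ENNReal.ofReal_sum_of_nonneg fun i _ => hnn i]
  exact Finset.sum_le_sum fun i _ => lintegral_neg_log_rnDeriv_le (hle i) 𝒟 hcov

section SelfSimilar

variable {E : Type*} [MetricSpace E] [CompleteSpace E] [SecondCountableTopology E]
  [HasBesicovitchCovering E] [MeasurableSpace E] [BorelSpace E] [Nonempty E]
  {ℓ : ℕ} {S : Fin ℓ → E → E} {ρ : Fin ℓ → ℝ}
  {P : Measure (Fin ℓ)} [IsProbabilityMeasure P] {μ : Measure E} [IsProbabilityMeasure μ]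

theorem ae_le_liminf_log_measure_closedBall_div_log [Nonempty (Fin ℓ)] (hρ0 : ∀ i, 0 < ρ i)
    (hρ1 : ∀ i, ρ i < 1) (hS : ∀ i x y, dist (S i x) (S i y) = ρ i * dist x y)
    (hP : ∀ i, 0 < P.real {i}) (hμ : μ = ∑ i, P {i} • μ.map (S i)) {s : ℝ}
    (hs : ∀ t, 0 ≤ t → t < s → ∑ i, ∫⁻ x, ENNReal.ofReal
      (-Real.log ((P {i} • μ.map (S i)).rnDeriv μ x).toReal) ∂(P {i} • μ.map (S i))
        < ENNReal.ofReal (-∑ i, P.real {i} * (Real.log (P.real {i}) - t * Real.log (ρ i)))) :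
    ∀ᵐ x ∂μ, s ≤ liminf (fun r : ℝ => Real.log (μ.real (Metric.closedBall x r)) / Real.log r)
      (𝓝[>] 0) := by
  have hcont : ∀ i, Continuous (S i) := fun i =>
    (LipschitzWith.of_dist_le_mul (K := ⟨ρ i, (hρ0 i).le⟩) fun x y => (hS i x y).le).continuous
  obtain ⟨i₁, hi₁⟩ := Finite.exists_max ρ
  obtain ⟨i₀, hi₀⟩ := Finite.exists_min ρ
  obtain ⟨j, hj⟩ := Finite.exists_min fun i => P.real {i}
  set θ := ρ i₁ with hθ
  have hθ0 : 0 < θ := hρ0 _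
  have hθ1 : θ < 1 := hρ1 _
  obtain ⟨π, hπ⟩ := exists_coding hρ0 hθ1 hi₁ hS
  obtain ⟨c, hc0, hc⟩ := exists_dist_coding_le hρ0 hθ1 hi₁ hS hπ
  have hπm := measurable_coding hcont hπ
  set β := P.real {j} / 2 with hβ
  have hβ0 : 0 < β := half_pos (hP j)
  have hβ1 : β < 1 := by
    have : P.real {j} ≤ 1 := measureReal_le_one
    linarith
  have hlow := pow_le_measure_closedBall_coding hρ0 hS hcont hπ hμ hc hβ0.le
    (fun i => (half_le_self (hP j).le).trans (hj i))
  have hpos : ∀ n ω, 0 < μ.real (Metric.closedBall (π ω) (c * wordRatio ρ n ω)) := fun n ω =>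
    (pow_pos hβ0 n).trans_le (hlow n ω)
  have hlow' : ∀ᵐ x ∂μ, ∀ n, β ^ n ≤ μ.real (Metric.closedBall x (c * θ ^ n)) := by
    have hm : MeasurableSet {x | ∀ n, β ^ n ≤ μ.real (Metric.closedBall x (c * θ ^ n))} := by
      refine measurableSet_setOfPred.2 (Measurable.forall fun n => ?_)
      exact measurableSet_setOfPred.1 (measurableSet_le measurable_const
        ((measurable_measure_closedBall μ).comp
          (measurable_id.prodMk measurable_const)).ennreal_toReal)
    conv => enter [2]; rw [← map_coding hcont hπ hμ]
    rw [ae_map_iff hπm.aemeasurable hm]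
    exact Eventually.of_forall fun ω n => (hlow n ω).trans (measureReal_mono
      (Metric.closedBall_subset_closedBall
        (mul_le_mul_of_nonneg_left (wordRatio_le_pow hρ0 hi₁ n ω) hc0.le)))
  have hup : ∀ t : ℚ, 0 ≤ t → t < s → ∀ᵐ x ∂μ, ∃ K : ℕ, ∀ q : ℚ, 0 < q →
      μ.real (Metric.closedBall x q) ≤ K * (q : ℝ) ^ (t : ℝ) := by
    intro t ht0 hts
    have ht0' : (0 : ℝ) ≤ t := by exact_mod_cast ht0
    have hm : MeasurableSet {x | ∃ K : ℕ, ∀ q : ℚ, 0 < q →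
        μ.real (Metric.closedBall x q) ≤ K * (q : ℝ) ^ (t : ℝ)} := by
      refine measurableSet_setOfPred.2 (Measurable.exists fun K => Measurable.forall fun q =>
        Measurable.imp measurable_const ?_)
      exact measurableSet_setOfPred.1 (measurableSet_le
        ((measurable_measure_closedBall μ).comp
          (measurable_id.prodMk measurable_const)).ennreal_toReal measurable_const)
    conv => enter [2]; rw [← map_coding hcont hπ hμ]
    rw [ae_map_iff hπm.aemeasurable hm]
    obtain ⟨N, hN⟩ := ae_exists_log_measure_closedBall_le hρ0 hθ1 hi₁ hS hcont hπ hμ hP hc0 hpos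
      (hs t ht0' hts)
    filter_upwards [hN] with ω hω
    obtain ⟨C, hC⟩ := hω
    obtain ⟨K, hK⟩ := exists_measure_closedBall_le_rpow (R := fun n => wordRatio ρ n ω) rfl
      (fun n => wordRatio_pos hρ0 n ω)
      (squeeze_zero (fun n => (wordRatio_pos hρ0 n ω).le) (fun n => wordRatio_le_pow hρ0 hi₁ n ω)
        (tendsto_pow_atTop_nhds_zero_of_lt_one hθ0.le hθ1))
      (hρ0 i₀) (hρ1 i₀).le (fun n k => wordRatio_mul_pow_le hρ0 (hρ0 i₀).le hi₀ n k ω) hc0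
      (fun n => hpos n ω) ht0' hC
    exact ⟨K, fun q hq => hK q (by exact_mod_cast hq)⟩
  filter_upwards [hlow', ae_all_iff.2 fun t =>
    eventually_imp_distrib_left.2 fun ht0 => eventually_imp_distrib_left.2 (hup t ht0)] with x hx1 hx2
  exact le_liminf_log_measure_div_log hβ0 hβ1 hθ0 hθ1 hc0 hx1 hx2

end SelfSimilar

theorem stmt0 {d ℓ : ℕ} (hℓ : 1 ≤ ℓ)
    (S : Fin ℓ → EuclideanSpace ℝ (Fin d) → EuclideanSpace ℝ (Fin d))
    (ρ p : Fin ℓ → ℝ)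
    (hρ0 : ∀ i, 0 < ρ i) (hρ1 : ∀ i, ρ i < 1)
    (hS : ∀ i x y, dist (S i x) (S i y) = ρ i * dist x y)
    (hp : ∀ i, 0 < p i) (hp1 : ∑ i, p i = 1)
    (μ : Measure (EuclideanSpace ℝ (Fin d))) [IsProbabilityMeasure μ]
    (hμ : ∀ A : Set (EuclideanSpace ℝ (Fin d)), MeasurableSet A →
      μ A = ∑ i, ENNReal.ofReal (p i) * μ (S i ⁻¹' A))
    (𝒟 : Finset (Set (EuclideanSpace ℝ (Fin d))))
    (h𝒟m : ∀ D ∈ 𝒟, MeasurableSet D)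
    (h𝒟u : μ (⋃ D ∈ 𝒟, D) = 1)
    (h𝒟d : ∀ D ∈ 𝒟, ∀ D' ∈ 𝒟, D ≠ D' → μ (D ∩ D') = 0) :
    ∀ᵐ x ∂μ,
      ((∑ i, -(p i * Real.log (p i))) -
          ∑ D ∈ 𝒟, fEnt (fun i => p i * (μ (S i ⁻¹' D)).toReal)) /
        (∑ i, -(p i * Real.log (ρ i))) ≤
      liminf (fun r : ℝ =>
        Real.log ((μ (Metric.closedBall x r)).toReal) / Real.log r) (𝓝[>] 0) := by
  have hne : Nonempty (Fin ℓ) := ⟨⟨0, hℓ⟩⟩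
  have hSm : ∀ i, Measurable (S i) := fun i =>
    (LipschitzWith.of_dist_le_mul (K := ⟨ρ i, (hρ0 i).le⟩)
      fun x y => (hS i x y).le).continuous.measurable
  set P : Measure (Fin ℓ) := ∑ i, ENNReal.ofReal (p i) • Measure.dirac i with hPdef
  have hPi : ∀ i, P {i} = ENNReal.ofReal (p i) := by
    intro i
    simp [hPdef, Set.indicator_apply]
  have hPr : ∀ i, P.real {i} = p i := fun i => by
    rw [measureReal_def, hPi, ENNReal.toReal_ofReal (hp i).le]
  have hPprob : IsProbabilityMeasure P := by
    constructor
    simp [hPdef, ← ENNReal.ofReal_sum_of_nonneg fun i _ => (hp i).le, hp1]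
  have hμ' : μ = ∑ i, P {i} • μ.map (S i) := by
    refine Measure.ext fun A hA => ?_
    rw [hμ A hA]
    simp [hPi, Measure.map_apply (hSm _) hA]
  have hcov : ∀ᵐ x ∂μ, x ∈ ⋃ D ∈ 𝒟, D :=
    (mem_ae_iff_prob_eq_one (Finset.measurableSet_biUnion 𝒟 h𝒟m)).2 h𝒟u
  obtain ⟨hent0, hent⟩ := sum_lintegral_neg_log_rnDeriv_le hμ' 𝒟 hcov
  have hD : ∑ D ∈ 𝒟, fEnt (fun i => (P {i} • μ.map (S i)).real D)
      = ∑ D ∈ 𝒟, fEnt (fun i => p i * (μ (S i ⁻¹' D)).toReal) := by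
    refine Finset.sum_congr rfl fun D hD => congrArg fEnt (funext fun i => ?_)
    rw [measureReal_ennreal_smul_apply, hPi, ENNReal.toReal_ofReal (hp i).le, measureReal_def,
      Measure.map_apply (hSm i) (h𝒟m D hD)]
  rw [hD] at hent0 hent
  refine ae_le_liminf_log_measure_closedBall_div_log hρ0 hρ1 hS (fun i => (hPr i).symm ▸ hp i) hμ'
    fun t ht0 hts => hent.trans_lt ?_
  have hχ : 0 < ∑ i, -(p i * Real.log (ρ i)) := Finset.sum_pos
    (fun i _ => neg_pos.2 (mul_neg_of_pos_of_neg (hp i) (Real.log_neg (hρ0 i) (hρ1 i))))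
    Finset.univ_nonempty
  rw [lt_div_iff₀ hχ] at hts
  have heq : -∑ i, P.real {i} * (Real.log (P.real {i}) - t * Real.log (ρ i))
      = (∑ i, -(p i * Real.log (p i))) - t * ∑ i, -(p i * Real.log (ρ i)) := by
    rw [Finset.mul_sum, ← Finset.sum_neg_distrib, ← Finset.sum_sub_distrib]
    refine Finset.sum_congr rfl fun i _ => ?_
    rw [hPr]
    ring
  rw [heq]
  exact (ENNReal.ofReal_lt_ofReal_iff_of_nonneg hent0).2 (by linarith)
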